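/- Define Laurent polynomials c_m ∈ ℤ[A, A^{−1}] by the recursion c_1 = A, c_{2k} = A^{−1}(A² + A^{−2}) c_{2k−1} for k ≥ 1, and c_{2k+1} = A(1 + (A² + A^{−2}) c_{2k}) for k ≥ 1. Then for every m ≥ 1: if m is odd, ((A² + A^{−2})² − 1) · c_m = A · ((A² + A^{−2})^{m+1} − 1), and if m is even, ((A² + A^{−2})² − 1) · c_m = (A² + A^{−2}) · ((A² + A^{−2})^{m} − 1). -/

import Mathlib

open LaurentPolynomial

/-- The Laurent polynomials `c_m ∈ ℤ[A, A⁻¹]` defined by the recursion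
`c₁ = A`, `c_{2k} = A⁻¹ (A² + A⁻²) c_{2k-1}` for `k ≥ 1`, and
`c_{2k+1} = A (1 + (A² + A⁻²) c_{2k})` for `k ≥ 1`.
Here `A = T 1` and `A⁻¹ = T (-1)` in `ℤ[T; T⁻¹]`. -/
noncomputable def c : ℕ → LaurentPolynomial ℤ
  | 0 => 0
  | 1 => T 1
  | (m + 2) =>
      if Even (m + 2) then T (-1) * (T 2 + T (-2)) * c (m + 1)
      else T 1 * (1 + (T 2 + T (-2)) * c (m + 1))

/-- For every `m ≥ 1`: if `m` is odd then
`((A² + A⁻²)² − 1) · c_m = A · ((A² + A⁻²)^{m+1} − 1)`, and if `m` is even then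
`((A² + A⁻²)² − 1) · c_m = (A² + A⁻²) · ((A² + A⁻²)^m − 1)`. -/
theorem c_closed_form (m : ℕ) (hm : 1 ≤ m) :
    (Odd m →
      ((T 2 + T (-2)) ^ 2 - 1) * c m = T 1 * ((T 2 + T (-2)) ^ (m + 1) - 1)) ∧
    (Even m →
      ((T 2 + T (-2)) ^ 2 - 1) * c m = (T 2 + T (-2)) * ((T 2 + T (-2)) ^ m - 1)) := by
  induction m, hm using Nat.le_induction with
  | base => exact ⟨fun _ => by rw [c]; ring, fun h => absurd h (by decide)⟩
  | succ n hn ih =>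
    obtain ⟨k, rfl⟩ := Nat.exists_eq_add_of_le' hn
    have hT : (T (-1) * T 1 : LaurentPolynomial ℤ) = 1 := by
      rw [← T_add, neg_add_cancel, T_zero]
    obtain ⟨ih_odd, ih_even⟩ := ih
    generalize hd : (T 2 + T (-2) : LaurentPolynomial ℤ) = d at ih_odd ih_even ⊢
    constructor
    · intro h
      have h_even : ¬Even (k + 2) := Nat.not_even_iff_odd.mpr h
      rw [c, if_neg h_even, hd]
      linear_combination T 1 * d * ih_even (by grind)
    · intro h
      have h_even : Even (k + 2) := h
      rw [c, if_pos h_even, hd]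
      linear_combination T (-1) * d * ih_odd (by grind) + d * (d ^ (k + 2) - 1) * hT
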